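/- arXiv:1102.3669 — 2 statements merged into one kernel-verified Lean document; each statement's English description precedes it below -/
import Mathlib

section
/- For every α, β ∈ (0,1): the sequence E_n := H(D_1 | D_0, X^n, y(X^n,D^n), D_{n+1}) satisfies E_n ≥ E_{n−1} for all n ≥ 2, and E_n ≤ 1 for all n ≥ 1; consequently E_∞ := lim_{n→∞} E_n exists. -/
open Filter

noncomputable section

open scoped Classical

namespace SyncDeletion

/-- The deletion output `y(x, d)`: the subsequence of `x` consisting of the bits `x i`
with `d i = false`, in order. -/
def yList (x d : List Bool) : List Bool :=
  ((x.zip d).filter (fun p => p.2 = false)).map Prod.fst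

/-- Binary entropy function (base-2), with `binEnt 0 = binEnt 1 = 0`. -/
def binEnt (p : ℝ) : ℝ := -(p * Real.logb 2 p) - (1 - p) * Real.logb 2 (1 - p)

/-- The constant `C = ∑_{l≥1} 2^{-l-1} l log₂ l` (the `l = 0` term vanishes). -/
def Cconst : ℝ := ∑' l : ℕ, (2 : ℝ) ^ (-(l : ℝ) - 1) * (l : ℝ) * Real.logb 2 (l : ℝ)

/-- Probability of an event `E` under a pmf `p` on a finite outcome space. -/
def prob {Ω : Type} [Fintype Ω] (p : Ω → ℝ) (E : Ω → Prop) : ℝ :=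
  ∑ ω ∈ Finset.univ.filter E, p ω

/-- Conditional Shannon entropy (in bits) `H(f | g)` of the random variable `f`
given `g`, under the pmf `p`. -/
def condEnt {Ω A B : Type} [Fintype Ω] (p : Ω → ℝ) (f : Ω → A) (g : Ω → B) : ℝ :=
  -∑ ab ∈ Finset.univ.image (fun ω => (f ω, g ω)),
    (if prob p (fun ω => f ω = ab.1 ∧ g ω = ab.2) = 0 then 0
     else prob p (fun ω => f ω = ab.1 ∧ g ω = ab.2) *
       Real.logb 2 (prob p (fun ω => f ω = ab.1 ∧ g ω = ab.2) /
         prob p (fun ω => g ω = ab.2)))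

/-- Shannon entropy (in bits) `H(f)` of the random variable `f` under the pmf `p`. -/
def ent {Ω A : Type} [Fintype Ω] (p : Ω → ℝ) (f : Ω → A) : ℝ :=
  condEnt p f (fun _ => ())

/-- Stationary initial distribution of the deletion-pattern Markov chain:
`P(D₀ = 1) = β/(α+β)`. -/
def initD (α β : ℝ) (b : Bool) : ℝ := if b then β / (α + β) else α / (α + β)

/-- Transition probabilities of the deletion-pattern Markov chain:
`P(1|1) = 1-α`, `P(0|1) = α`, `P(1|0) = β`, `P(0|0) = 1-β`. -/
def transD (α β : ℝ) (b b' : Bool) : ℝ :=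
  if b then (if b' then 1 - α else α) else (if b' then β else 1 - β)

/-- Probability of a trajectory of the stationary two-state Markov chain. -/
def pMarkov (α β : ℝ) {m : ℕ} (dp : Fin (m + 1) → Bool) : ℝ :=
  initD α β (dp 0) * ∏ i : Fin m, transD α β (dp i.castSucc) (dp i.succ)

/-- Joint pmf of the iid Bernoulli(1/2) source `X^n = ω.1` and the independent
deletion pattern `(D_0, …, D_{n+1}) = ω.2`. -/
def pJoint (α β : ℝ) (n : ℕ) (ω : (Fin n → Bool) × (Fin (n + 2) → Bool)) : ℝ :=
  (1 / 2 : ℝ) ^ n * pMarkov α β (m := n + 1) ω.2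

/-- The deletion output `y(X^n, D^n)`: bits `X_i` with `D_i = 0` in order
(source bit `X_i` is governed by pattern bit `D_i`, i.e. index `i` of `ω.2`,
for `i = 1, …, n`). -/
def yOut {n : ℕ} (ω : (Fin n → Bool) × (Fin (n + 2) → Bool)) : List Bool :=
  yList (List.ofFn ω.1)
    (List.ofFn (fun i : Fin n => ω.2 ⟨i.val + 1, by have := i.isLt; omega⟩))

/-- `a_n = H(X^n | y(X^n, D^n), D_0, D_{n+1})`. -/
def aSeq (α β : ℝ) (n : ℕ) : ℝ :=
  condEnt (pJoint α β n) (fun ω => ω.1)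
    (fun ω => (yOut ω, ω.2 0, ω.2 (Fin.last (n + 1))))

/-- `E_n = H(D_1 | D_0, X^n, y(X^n, D^n), D_{n+1})`. -/
def Eseq (α β : ℝ) (n : ℕ) : ℝ :=
  condEnt (pJoint α β n) (fun ω => ω.2 1)
    (fun ω => (ω.2 0, ω.1, yOut ω, ω.2 (Fin.last (n + 1))))

/-- `H(y(X^n, D^n) | X^n, D_0, D_{n+1})`. -/
def hygSeq (α β : ℝ) (n : ℕ) : ℝ :=
  condEnt (pJoint α β n) (fun ω => yOut ω)
    (fun ω => (ω.1, ω.2 0, ω.2 (Fin.last (n + 1))))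

/-- `J_n = d + (1/n) H(y(X^n, D^n) | X^n, D_0, D_{n+1})` with `d = β/(α+β)`. -/
def Jseq (α β : ℝ) (n : ℕ) : ℝ := β / (α + β) + hygSeq α β n / n

/-- `I_n/n`: the normalized mutual information
`(1/n)(H(y(X^n,D^n)) - H(y(X^n,D^n)|X^n))`. -/
def Iseq (α β : ℝ) (n : ℕ) : ℝ :=
  (ent (pJoint α β n) (fun ω => yOut ω) -
    condEnt (pJoint α β n) (fun ω => yOut ω) (fun ω => ω.1)) / n

/-- Error probability of a code `(enc, dec)` with message set `Fin M`. -/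
def errProb (α β : ℝ) (n M : ℕ) (enc : (Fin n → Bool) → Fin M)
    (dec : Fin M × List Bool → (Fin n → Bool)) : ℝ :=
  prob (pJoint α β n) (fun ω => dec (enc ω.1, yOut ω) ≠ ω.1)

/-- `R` is an achievable rate: there is a sequence of codes whose error probability
tends to `0` and whose rate `(1/n) log₂ |M_n|` has limsup at most `R`. -/
def IsAchievable (α β R : ℝ) : Prop :=
  ∃ M : ℕ → ℕ, ∃ enc : (n : ℕ) → (Fin n → Bool) → Fin (M n),
    ∃ dec : (n : ℕ) → Fin (M n) × List Bool → (Fin n → Bool),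
      Tendsto (fun n => errProb α β n (M n) (enc n) (dec n)) atTop (nhds 0) ∧
      Filter.limsup (fun n : ℕ => Real.logb 2 (M n : ℝ) / (n : ℝ)) atTop ≤ R

/-- The minimum achievable rate `R_min(α, β)`. -/
def Rmin (α β : ℝ) : ℝ := sInf {R : ℝ | IsAchievable α β R}

/-- `k = max {6, -6 / log₂(1-α)}`. -/
def kconst (α : ℝ) : ℝ := max 6 (-6 / Real.logb 2 (1 - α))

/-- `m = ⌊-k log₂ β⌋`. -/
def mlen (α β : ℝ) : ℕ := ⌊kconst α * (-Real.logb 2 β)⌋₊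

/-- Number of ones among the entries of `dp` with index `≤ m`. -/
def onesCount {N : ℕ} (dp : Fin N → Bool) (m : ℕ) : ℕ :=
  (Finset.univ.filter (fun i : Fin N => i.val ≤ m ∧ dp i = true)).card

/-- Number of maximal runs of 1's among the entries of `dp` with index `≤ m`
(counted by their starting positions). -/
def runsCount {N : ℕ} (dp : Fin N → Bool) (m : ℕ) : ℕ :=
  (Finset.univ.filter (fun i : Fin N => i.val ≤ m ∧ dp i = true ∧
    (i.val = 0 ∨ dp ⟨i.val - 1, lt_of_le_of_lt (Nat.sub_le _ _) i.isLt⟩ = false))).card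

/-- The deletion pattern `(D_0, …, D_{n+1})` is typical: `(D_0, …, D_m)` contains at
most one maximal run of 1's and at most `⌊(k/3)(-log₂ β)⌋` ones, for `m = ⌊-k log₂ β⌋`. -/
def Typical (α β : ℝ) {n : ℕ} (dp : Fin (n + 2) → Bool) : Prop :=
  runsCount dp (mlen α β) ≤ 1 ∧
    onesCount dp (mlen α β) ≤ ⌊(kconst α / 3) * (-Real.logb 2 β)⌋₊

/-- The joint pmf conditioned on the event `{T = 1}` that the deletion pattern is typical. -/
def pTypCond (α β : ℝ) (n : ℕ) (ω : (Fin n → Bool) × (Fin (n + 2) → Bool)) : ℝ :=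
  if Typical α β ω.2 then
    pJoint α β n ω / prob (pJoint α β n) (fun ω' => Typical α β ω'.2)
  else 0

/-- `H(D_1 | X^n, y(X^n,D^n), D_0, D_{n+1}, T = 1) ⬝ P(T = 1)`. -/
def EseqTyp (α β : ℝ) (n : ℕ) : ℝ :=
  condEnt (pTypCond α β n) (fun ω => ω.2 1)
    (fun ω => (ω.2 0, ω.1, yOut ω, ω.2 (Fin.last (n + 1)))) *
  prob (pJoint α β n) (fun ω => Typical α β ω.2)

/-- `(1/k) H(X_2^{k-1} | y(X_2^{k-1}, D_2^{k-1}), D_1, D_k)` (unnormalized). -/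
def innerEnt (α β : ℝ) (k : ℕ) : ℝ :=
  condEnt (pJoint α β k)
    (fun ω => (fun i : Fin (k - 2) => ω.1 ⟨i.val + 1, by have := i.isLt; omega⟩))
    (fun ω =>
      (yList (List.ofFn (fun i : Fin (k - 2) => ω.1 ⟨i.val + 1, by have := i.isLt; omega⟩))
        (List.ofFn (fun i : Fin (k - 2) => ω.2 ⟨i.val + 2, by have := i.isLt; omega⟩)),
       ω.2 1, ω.2 ⟨k, by omega⟩))

/-- Probability as a sum of indicators. -/
lemma prob_eq_sum_ite {Ω : Type} [Fintype Ω] (p : Ω → ℝ) (E : Ω → Prop) :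
    prob p E = ∑ ω, if E ω then p ω else 0 := by
  rw [prob, Finset.sum_filter]

lemma prob_pos {Ω : Type} [Fintype Ω] {p : Ω → ℝ} (hp : ∀ ω, 0 < p ω) {E : Ω → Prop}
    {ω : Ω} (hω : E ω) : 0 < prob p E :=
  Finset.sum_pos (fun _ _ => hp _) ⟨ω, by simpa using hω⟩

lemma prob_nonneg {Ω : Type} [Fintype Ω] {p : Ω → ℝ} (hp : ∀ ω, 0 < p ω) (E : Ω → Prop) :
    0 ≤ prob p E :=
  Finset.sum_nonneg fun _ _ => (hp _).le

/-- A weighted sum of a function of `h` is a sum over the values of `h`. -/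
lemma sum_mul_comp_eq_sum_image {Ω C : Type} [Fintype Ω] [DecidableEq C] (p : Ω → ℝ) (h : Ω → C) (F : C → ℝ) :
    ∑ ω, p ω * F (h ω) = ∑ c ∈ Finset.univ.image h, prob p (fun ω => h ω = c) * F c := by
  rw [← Finset.sum_fiberwise_of_maps_to (t := Finset.univ.image h) (g := h)
    (fun ω _ => Finset.mem_image_of_mem h (Finset.mem_univ ω))]
  refine Finset.sum_congr rfl fun c _ => ?_
  rw [prob, Finset.sum_mul]
  refine Finset.sum_congr (by ext; simp) fun ω hω => ?_
  have hc : h ω = c := by simpa using hω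
  rw [hc]

/-- Conditional entropy as the expectation of the conditional information content. -/
lemma condEnt_eq_sum {Ω A B : Type} [Fintype Ω] {p : Ω → ℝ} (hp : ∀ ω, 0 < p ω)
    (f : Ω → A) (g : Ω → B) :
    condEnt p f g = -∑ ω, p ω * Real.logb 2
      (prob p (fun ω' => f ω' = f ω ∧ g ω' = g ω) / prob p (fun ω' => g ω' = g ω)) := by
  rw [sum_mul_comp_eq_sum_image p (fun ω => (f ω, g ω)) (fun ab => Real.logb 2
    (prob p (fun ω' => f ω' = ab.1 ∧ g ω' = ab.2) / prob p (fun ω' => g ω' = ab.2))), condEnt]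
  refine congrArg _ (Finset.sum_congr rfl fun ab hab => ?_)
  obtain ⟨ω, -, rfl⟩ := Finset.mem_image.1 hab
  rw [if_neg (prob_pos hp (ω := ω) ⟨rfl, rfl⟩).ne']
  simp only [Prod.mk.injEq]

/-- The Gibbs inequality: conditional entropy is at most the cross entropy relative to any
(sub-)probability kernel `q`. -/
lemma condEnt_le_cross {Ω A B : Type} [Fintype Ω] [Fintype A] {p : Ω → ℝ}
    (hp : ∀ ω, 0 < p ω) (f : Ω → A) (g : Ω → B) (q : A → B → ℝ) (hq : ∀ a b, 0 ≤ q a b)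
    (hq1 : ∀ b, ∑ a, q a b ≤ 1) (hpos : ∀ ω, 0 < q (f ω) (g ω)) :
    condEnt p f g ≤ -∑ ω, p ω * Real.logb 2 (q (f ω) (g ω)) := by
  rw [condEnt_eq_sum hp, neg_le_neg_iff]
  set J : A → B → ℝ := fun a b => prob p (fun ω' => f ω' = a ∧ g ω' = b) with hJ
  set M : B → ℝ := fun b => prob p (fun ω' => g ω' = b) with hM
  have hJpos : ∀ ω, 0 < J (f ω) (g ω) := fun ω => prob_pos hp (ω := ω) ⟨rfl, rfl⟩
  have hMpos : ∀ ω, 0 < M (g ω) := fun ω => prob_pos hp (ω := ω) rfl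
  have htotal : ∑ ω, p ω * (q (f ω) (g ω) * M (g ω) / J (f ω) (g ω)) ≤ ∑ ω, p ω := by
    calc ∑ ω, p ω * (q (f ω) (g ω) * M (g ω) / J (f ω) (g ω))
        = ∑ ab ∈ Finset.univ.image (fun ω => (f ω, g ω)), q ab.1 ab.2 * M ab.2 := by
          rw [sum_mul_comp_eq_sum_image p (fun ω => (f ω, g ω))
            (fun ab => q ab.1 ab.2 * M ab.2 / J ab.1 ab.2)]
          refine Finset.sum_congr rfl fun ab hab => ?_
          obtain ⟨ω, -, rfl⟩ := Finset.mem_image.1 hab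
          simp only [Prod.mk.injEq]
          exact mul_div_cancel₀ _ (hJpos ω).ne'
      _ ≤ ∑ ab ∈ Finset.univ ×ˢ Finset.univ.image g, q ab.1 ab.2 * M ab.2 := by
          refine Finset.sum_le_sum_of_subset_of_nonneg ?_
            fun ab _ _ => mul_nonneg (hq _ _) (prob_nonneg hp _)
          intro ab hab
          obtain ⟨ω, -, rfl⟩ := Finset.mem_image.1 hab
          simp
      _ = ∑ b ∈ Finset.univ.image g, M b * ∑ a, q a b := by
          rw [Finset.sum_product_right]
          simp only [Finset.mul_sum, mul_comm]
      _ ≤ ∑ b ∈ Finset.univ.image g, M b * 1 :=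
          Finset.sum_le_sum fun b _ => mul_le_mul_of_nonneg_left (hq1 b) (prob_nonneg hp _)
      _ = ∑ ω, p ω := by
          rw [← sum_mul_comp_eq_sum_image p g (fun _ => 1)]
          simp
  have hlog : ∀ ω, p ω * Real.logb 2 (q (f ω) (g ω)) -
      p ω * Real.logb 2 (J (f ω) (g ω) / M (g ω)) ≤
      (p ω * (q (f ω) (g ω) * M (g ω) / J (f ω) (g ω)) - p ω) / Real.log 2 := by
    intro ω
    have h := Real.log_le_sub_one_of_pos
      (div_pos (mul_pos (hpos ω) (hMpos ω)) (hJpos ω))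
    rw [Real.log_div (mul_pos (hpos ω) (hMpos ω)).ne' (hJpos ω).ne',
      Real.log_mul (hpos ω).ne' (hMpos ω).ne'] at h
    rw [Real.logb, Real.logb, Real.log_div (hJpos ω).ne' (hMpos ω).ne', ← mul_div_assoc,
      ← mul_div_assoc, ← sub_div]
    refine div_le_div_of_nonneg_right ?_ (Real.log_nonneg one_le_two)
    nlinarith [mul_le_mul_of_nonneg_left h (hp ω).le]
  have hsum := Finset.sum_le_sum fun ω (_ : ω ∈ Finset.univ) => hlog ω
  rw [Finset.sum_sub_distrib, ← Finset.sum_div, Finset.sum_sub_distrib] at hsum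
  have hneg := div_nonpos_of_nonpos_of_nonneg (sub_nonpos.2 htotal)
    (Real.log_nonneg one_le_two)
  linarith

/-- Conditioning on a function of a variable instead of the variable itself does not
decrease entropy. -/
lemma condEnt_le_condEnt_comp {Ω A B C : Type} [Fintype Ω] [Fintype A] {p : Ω → ℝ}
    (hp : ∀ ω, 0 < p ω) (f : Ω → A) (g' : Ω → C) (φ : C → B) :
    condEnt p f g' ≤ condEnt p f (fun ω => φ (g' ω)) := by
  rw [condEnt_eq_sum hp f (fun ω => φ (g' ω))]
  refine condEnt_le_cross hp f g' (fun a c =>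
    prob p (fun ω' => f ω' = a ∧ φ (g' ω') = φ c) / prob p (fun ω' => φ (g' ω') = φ c))
    (fun _ _ => div_nonneg (prob_nonneg hp _) (prob_nonneg hp _)) (fun c => ?_)
    (fun ω => div_pos (prob_pos hp (ω := ω) ⟨rfl, rfl⟩) (prob_pos hp (ω := ω) rfl))
  rw [← Finset.sum_div]
  refine div_le_one_of_le₀ (le_of_eq ?_) (prob_nonneg hp _)
  simp only [prob_eq_sum_ite]
  rw [Finset.sum_comm]
  refine Finset.sum_congr rfl fun ω _ => ?_
  by_cases h : φ (g' ω) = φ c <;> simp [h]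

/-- A binary variable has conditional entropy at most one bit. -/
lemma condEnt_bool_le_one {Ω B : Type} [Fintype Ω] {p : Ω → ℝ} (hp : ∀ ω, 0 < p ω)
    (hsum : ∑ ω, p ω = 1) (f : Ω → Bool) (g : Ω → B) : condEnt p f g ≤ 1 := by
  refine (condEnt_le_cross hp f g (fun _ _ => 1 / 2) (fun _ _ => by norm_num)
    (fun _ => by simp) (fun _ => by norm_num)).trans ?_
  rw [← Finset.sum_mul, hsum]
  simp [Real.logb_inv]

/-- Additionally conditioning on a variable `k` that depends on the rest only through `g`
does not change the conditional entropy given `g`. -/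
lemma condEnt_extend {Ω Ω' K A B : Type} [Fintype Ω] [Fintype Ω'] [Fintype K]
    {p : Ω → ℝ} {p' : Ω' → ℝ} (hp : ∀ ω, 0 < p ω) (hp' : ∀ ω, 0 < p' ω)
    (e : Ω × K ≃ Ω') (f : Ω → A) (g : Ω → B) (w : B → K → ℝ)
    (hw : ∀ ω k, 0 < w (g ω) k) (hw1 : ∀ ω, ∑ k, w (g ω) k = 1)
    (hpw : ∀ ω k, p' (e (ω, k)) = p ω * w (g ω) k) :
    condEnt p' (fun ω' => f (e.symm ω').1) (fun ω' => (g (e.symm ω').1, (e.symm ω').2)) =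
      condEnt p f g := by
  have hprob : ∀ (E : Ω → Prop) (b : B) (k : K),
      prob p' (fun ω' => E (e.symm ω').1 ∧ (g (e.symm ω').1, (e.symm ω').2) = (b, k)) =
        prob p (fun ω => E ω ∧ g ω = b) * w b k := by
    intro E b k
    simp only [prob_eq_sum_ite]
    rw [← Equiv.sum_comp e, Fintype.sum_prod_type, Finset.sum_mul]
    refine Finset.sum_congr rfl fun ω _ => ?_
    simp only [Equiv.symm_apply_apply, Prod.mk.injEq, hpw]
    by_cases hE : E ω
    · by_cases hb : g ω = b
      · subst hb
        simp [hE]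
      · simp [hb]
    · simp [hE]
  have hprob' : ∀ (b : B) (k : K),
      prob p' (fun ω' => (g (e.symm ω').1, (e.symm ω').2) = (b, k)) =
        prob p (fun ω => g ω = b) * w b k := by
    intro b k
    simpa using hprob (fun _ => True) b k
  rw [condEnt_eq_sum hp, condEnt_eq_sum hp', ← Equiv.sum_comp e, Fintype.sum_prod_type]
  refine congrArg _ (Finset.sum_congr rfl fun ω _ => ?_)
  simp only [Equiv.symm_apply_apply, hpw]
  calc _ = ∑ k, p ω * w (g ω) k * Real.logb 2
        (prob p (fun ω' => f ω' = f ω ∧ g ω' = g ω) / prob p (fun ω' => g ω' = g ω)) := by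
        refine Finset.sum_congr rfl fun k _ => ?_
        rw [hprob (fun ω' => f ω' = f ω), hprob', mul_div_mul_right _ _ (hw ω k).ne']
    _ = _ := by rw [← Finset.sum_mul, ← Finset.mul_sum, hw1, mul_one]

lemma transD_pos {α β : ℝ} (hα : 0 < α ∧ α < 1) (hβ : 0 < β ∧ β < 1) (b b' : Bool) :
    0 < transD α β b b' := by
  cases b <;> cases b' <;> simp [transD, hα, hβ]

lemma sum_transD (α β : ℝ) (b : Bool) : ∑ b', transD α β b b' = 1 := by
  cases b <;> simp [transD]

lemma initD_pos {α β : ℝ} (hα : 0 < α) (hβ : 0 < β) (b : Bool) : 0 < initD α β b := by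
  cases b <;> simp only [initD] <;> positivity

lemma pJoint_pos {α β : ℝ} (hα : 0 < α ∧ α < 1) (hβ : 0 < β ∧ β < 1) (n : ℕ)
    (ω : (Fin n → Bool) × (Fin (n + 2) → Bool)) : 0 < pJoint α β n ω :=
  mul_pos (by positivity) (mul_pos (initD_pos hα.1 hβ.1 _)
    (Finset.prod_pos fun _ _ => transD_pos hα hβ _ _))

/-- Splitting off the last source bit and the last pattern bit. -/
def snocEquiv (n : ℕ) : ((Fin n → Bool) × (Fin (n + 2) → Bool)) × (Bool × Bool) ≃
    (Fin (n + 1) → Bool) × (Fin (n + 3) → Bool) where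
  toFun q := (Fin.snoc q.1.1 q.2.1, Fin.snoc q.1.2 q.2.2)
  invFun ω := ((Fin.init ω.1, Fin.init ω.2), (ω.1 (Fin.last n), ω.2 (Fin.last (n + 2))))
  left_inv q := by simp
  right_inv ω := by simp

lemma pJoint_snoc (α β : ℝ) (n : ℕ) (ω : (Fin n → Bool) × (Fin (n + 2) → Bool))
    (k : Bool × Bool) :
    pJoint α β (n + 1) (snocEquiv n (ω, k)) =
      pJoint α β n ω * (1 / 2 * transD α β (ω.2 (Fin.last (n + 1))) k.2) := by
  have h0 : (Fin.snoc ω.2 k.2 : Fin (n + 3) → Bool) 0 = ω.2 0 := by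
    rw [← Fin.castSucc_zero, Fin.snoc_castSucc]
  have hprod : ∏ i : Fin (n + 2), transD α β ((Fin.snoc ω.2 k.2 : Fin (n + 3) → Bool) i.castSucc)
      ((Fin.snoc ω.2 k.2 : Fin (n + 3) → Bool) i.succ) =
      (∏ i : Fin (n + 1), transD α β (ω.2 i.castSucc) (ω.2 i.succ)) *
        transD α β (ω.2 (Fin.last (n + 1))) k.2 := by
    rw [Fin.prod_univ_castSucc]
    simp only [Fin.succ_castSucc, Fin.snoc_castSucc, Fin.succ_last, Fin.snoc_last]
  simp only [pJoint, pMarkov, snocEquiv, Equiv.coe_fn_mk]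
  rw [h0, hprod, pow_succ]
  ring

lemma sum_pJoint {α β : ℝ} (hα : 0 < α) (hβ : 0 < β) (n : ℕ) :
    ∑ ω, pJoint α β n ω = 1 := by
  induction n with
  | zero =>
    have hne : α + β ≠ 0 := (add_pos hα hβ).ne'
    rw [Fintype.sum_prod_type, Fintype.sum_unique,
      ← Equiv.sum_comp (finTwoArrowEquiv Bool).symm, Fintype.sum_prod_type]
    simp [pJoint, pMarkov, initD, transD, finTwoArrowEquiv]
    field_simp
    ring
  | succ n ih =>
    rw [← Equiv.sum_comp (snocEquiv n), Fintype.sum_prod_type, ← ih]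
    refine Finset.sum_congr rfl fun ω _ => ?_
    simp only [pJoint_snoc, Fintype.sum_prod_type, ← Finset.mul_sum, sum_transD]
    simp

lemma yList_concat {x d : List Bool} (h : x.length = d.length) (a b : Bool) :
    yList (x ++ [a]) (d ++ [b]) = if b then yList x d else yList x d ++ [a] := by
  cases b <;> simp [yList, List.zip_append h]

/-- The deletion output after one more step. -/
lemma yOut_succ {n : ℕ} (ω : (Fin (n + 1) → Bool) × (Fin (n + 3) → Bool)) :
    yOut ω = if ω.2 (Fin.last (n + 1)).castSucc
      then yOut (Fin.init ω.1, (Fin.init ω.2 : Fin (n + 2) → Bool))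
      else yOut (Fin.init ω.1, (Fin.init ω.2 : Fin (n + 2) → Bool)) ++ [ω.1 (Fin.last n)] := by
  unfold yOut
  rw [List.ofFn_succ', List.ofFn_succ', List.concat_eq_append, List.concat_eq_append,
    yList_concat (by simp)]
  rfl

lemma Eseq_le_succ {α β : ℝ} (hα : 0 < α ∧ α < 1) (hβ : 0 < β ∧ β < 1) (n : ℕ) :
    Eseq α β n ≤ Eseq α β (n + 1) := by
  have hext := condEnt_extend (pJoint_pos hα hβ n) (pJoint_pos hα hβ (n + 1)) (snocEquiv n)
    (fun ω => ω.2 1) (fun ω => (ω.2 0, ω.1, yOut ω, ω.2 (Fin.last (n + 1))))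
    (fun b k => 1 / 2 * transD α β b.2.2.2 k.2)
    (fun ω k => mul_pos one_half_pos (transD_pos hα hβ _ _))
    (fun ω => by
      simp only [Fintype.sum_prod_type, ← Finset.mul_sum, sum_transD]
      simp)
    (pJoint_snoc α β n)
  rw [Eseq, ← hext]
  refine (condEnt_le_condEnt_comp (pJoint_pos hα hβ (n + 1)) _ _
    (fun c : (Bool × (Fin n → Bool) × List Bool × Bool) × (Bool × Bool) =>
      (c.1.1, (Fin.snoc c.1.2.1 c.2.1 : Fin (n + 1) → Bool),
        (if c.1.2.2.2 then c.1.2.2.1 else c.1.2.2.1 ++ [c.2.1]), c.2.2))).trans (le_of_eq ?_)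
  rw [Eseq]
  congr 1
  funext ω
  rw [yOut_succ]
  simp only [snocEquiv, Equiv.coe_fn_symm_mk, Fin.snoc_init_self]
  rfl

/-- For every `α, β ∈ (0,1)`: the sequence
`E_n = H(D_1 | D_0, X^n, y(X^n,D^n), D_{n+1})` satisfies `E_n ≥ E_{n−1}` for all `n ≥ 2`
and `E_n ≤ 1` for all `n ≥ 1`; consequently `E_∞ = lim_n E_n` exists. -/
theorem Eseq_monotone_bounded_converges (α β : ℝ) (hα : 0 < α ∧ α < 1)
    (hβ : 0 < β ∧ β < 1) :
    (∀ n : ℕ, 2 ≤ n → Eseq α β (n - 1) ≤ Eseq α β n) ∧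
    (∀ n : ℕ, 1 ≤ n → Eseq α β n ≤ 1) ∧
    ∃ Einf : ℝ, Tendsto (fun n : ℕ => Eseq α β n) atTop (nhds Einf) := by
  have hmono : Monotone (Eseq α β) := monotone_nat_of_le_succ (Eseq_le_succ hα hβ)
  have hle : ∀ n, Eseq α β n ≤ 1 := fun n =>
    condEnt_bool_le_one (pJoint_pos hα hβ n) (sum_pJoint hα.1 hβ.1 n) _ _
  exact ⟨fun n _ => hmono (Nat.sub_le n 1), fun n _ => hle n, _,
    tendsto_atTop_ciSup hmono ⟨1, Set.forall_mem_range.2 hle⟩⟩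

end SyncDeletion
end
end

section
/- The series Σ_{l=1}^∞ h₂(1/l)·l·2^{−l} and Σ_{l=1}^∞ 2^{−l−1}·l·log₂ l both converge and are equal: Σ_{l=1}^∞ h₂(1/l)·l·2^{−l} = Σ_{l=1}^∞ 2^{−l−1}·l·log₂ l. -/
open Filter

noncomputable section

open scoped Classical

namespace SyncDeletion

theorem two_rpow_neg_natCast_add_one (l : ℕ) :
    (2 : ℝ) ^ (-((l : ℝ) + 1)) = (1 / 2) ^ (l + 1) := by
  rw [Real.rpow_neg zero_le_two, one_div, inv_pow, ← Real.rpow_natCast]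
  push_cast
  rfl

theorem two_rpow_neg_natCast_add_one_sub_one (l : ℕ) :
    (2 : ℝ) ^ (-((l : ℝ) + 1) - 1) = (1 / 2) ^ (l + 2) := by
  rw [Real.rpow_sub zero_lt_two, Real.rpow_one, two_rpow_neg_natCast_add_one]
  ring

/-- The scaled entropy `n h₂(1/n)` is a difference of consecutive values of `x log₂ x`. -/
theorem binEnt_one_div_mul (l : ℕ) :
    binEnt (1 / ((l : ℝ) + 1)) * ((l : ℝ) + 1) =
      ((l : ℝ) + 1) * Real.logb 2 ((l : ℝ) + 1) - l * Real.logb 2 l := by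
  have hl : (l : ℝ) + 1 ≠ 0 := by positivity
  have hsub : 1 - 1 / ((l : ℝ) + 1) = l / (l + 1) := by field_simp; ring
  rw [binEnt, hsub, one_div, Real.logb_inv]
  rcases eq_or_ne (l : ℝ) 0 with h | h
  · simp [h]
  · rw [Real.logb_div h hl]
    field_simp
    ring

theorem summable_mul_logb_mul_geometric :
    Summable fun l : ℕ => (l : ℝ) * Real.logb 2 l * (1 / 2) ^ (l + 1) := by
  have hlog : 0 < Real.log 2 := Real.log_pos one_lt_two
  have hgeom : Summable fun l : ℕ => (l : ℝ) ^ 2 * (1 / 2 : ℝ) ^ l :=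
    summable_pow_mul_geometric_of_norm_lt_one 2 (by norm_num)
  refine Summable.of_nonneg_of_le (fun l => ?_) (fun l => ?_)
    (hgeom.mul_left (1 / 2 / Real.log 2))
  · have : 0 ≤ Real.logb 2 l := div_nonneg (Real.log_natCast_nonneg l) hlog.le
    positivity
  · have h : Real.logb 2 l ≤ l / Real.log 2 :=
      div_le_div_of_nonneg_right (Real.log_le_self l.cast_nonneg) hlog.le
    calc (l : ℝ) * Real.logb 2 l * (1 / 2) ^ (l + 1)
        ≤ l * (l / Real.log 2) * (1 / 2) ^ (l + 1) := by gcongr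
      _ = 1 / 2 / Real.log 2 * ((l : ℝ) ^ 2 * (1 / 2) ^ l) := by ring

/-- The series `∑_{l≥1} h₂(1/l) l 2^{−l}` and `∑_{l≥1} 2^{−l−1} l log₂ l`
both converge and are equal. -/
theorem series_h2_eq_series_log :
    Summable (fun l : ℕ =>
      binEnt (1 / ((l : ℝ) + 1)) * ((l : ℝ) + 1) * (2 : ℝ) ^ (-((l : ℝ) + 1))) ∧
    Summable (fun l : ℕ =>
      (2 : ℝ) ^ (-((l : ℝ) + 1) - 1) * ((l : ℝ) + 1) * Real.logb 2 ((l : ℝ) + 1)) ∧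
    ∑' l : ℕ, binEnt (1 / ((l : ℝ) + 1)) * ((l : ℝ) + 1) * (2 : ℝ) ^ (-((l : ℝ) + 1)) =
      ∑' l : ℕ, (2 : ℝ) ^ (-((l : ℝ) + 1) - 1) * ((l : ℝ) + 1) * Real.logb 2 ((l : ℝ) + 1) := by
  set u : ℕ → ℝ := fun l => (l : ℝ) * Real.logb 2 l * (1 / 2) ^ (l + 1) with hu
  have hsum : Summable u := summable_mul_logb_mul_geometric
  have hshift : Summable fun l => u (l + 1) := (summable_nat_add_iff 1).2 hsum
  have hent : (fun l : ℕ => binEnt (1 / ((l : ℝ) + 1)) * ((l : ℝ) + 1) *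
      (2 : ℝ) ^ (-((l : ℝ) + 1))) = fun l => 2 * u (l + 1) - u l := by
    funext l
    rw [binEnt_one_div_mul, two_rpow_neg_natCast_add_one]
    simp only [hu]
    push_cast
    ring
  have hlog : (fun l : ℕ => (2 : ℝ) ^ (-((l : ℝ) + 1) - 1) * ((l : ℝ) + 1) *
      Real.logb 2 ((l : ℝ) + 1)) = fun l => u (l + 1) := by
    funext l
    rw [two_rpow_neg_natCast_add_one_sub_one]
    simp only [hu]
    push_cast
    ring
  have htsum : ∑' l, u l = ∑' l, u (l + 1) := by
    simpa [hu] using hsum.tsum_eq_zero_add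
  rw [hent, hlog]
  refine ⟨(hshift.mul_left 2).sub hsum, hshift, ?_⟩
  rw [(hshift.mul_left 2).tsum_sub hsum, tsum_mul_left, htsum]
  ring

end SyncDeletion
end
end
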